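/- Let X be a Banach space and h ≥ 1 a constant. Suppose (B(n))_{n∈ℤ₊} are bounded linear operators on X with the property: for every bounded sequence (s(n))_{n≥0} in X, there exists a sequence (x̃(n))_{n≥0} with x̃(0) = s(0), x̃(n+1) = B(n)x̃(n) + s(n+1) for all n ≥ 0, and sup_{n≥0}|x̃(n)| ≤ h·sup_{n≥0}|s(n)|. Then for every v ∈ X and every n ≥ 1, |Φ(n)v| ≤ h|v|, where Φ(n) = B(n−1)···B(0); moreover, choosing n₀ ∈ ℕ with h²/(n₀+1) ≤ 1/e, one has |Φ_m(n₀)v| ≤ e^{-1}|v| for the cocycle started at any time m, and consequently there exist Q > 0 and ν > 0 (Q = h·e, ν = 1/n₀) such that |Φ_m(n)v| ≤ Q e^{-ν n}|v| for all n ≥ 1, where Φ_m(n) = B(m+n−1)···B(m), provided the admissibility hypothesis holds uniformly at every starting time m. -/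

import Mathlib

/-- the abstract "bounded input implies exponential decay" argument:
uniform admissibility at every starting time `m` yields `‖Φ_m(n)v‖ ≤ h‖v‖`, then
`‖Φ_m(n₀)v‖ ≤ e⁻¹‖v‖` whenever `h²/(n₀+1) ≤ 1/e`, and consequently the exponential
estimate `‖Φ_m(n)v‖ ≤ Q e^{-νn}‖v‖` with `Q = h·e`, `ν = 1/n₀`. -/
theorem stmt_10 {X : Type*} [NormedAddCommGroup X] [NormedSpace ℝ X] [CompleteSpace X]
    (B : ℕ → X →L[ℝ] X) (h : ℝ) (hh : 1 ≤ h)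
    (Φ : ℕ → ℕ → X →L[ℝ] X)
    (hΦ0 : ∀ m : ℕ, Φ m 0 = 1)
    (hΦs : ∀ m n : ℕ, Φ m (n + 1) = (B (m + n)).comp (Φ m n))
    (hadm : ∀ (m : ℕ) (s : ℕ → X) (C : ℝ), (∀ n : ℕ, ‖s n‖ ≤ C) →
      ∃ x : ℕ → X, x 0 = s 0 ∧ (∀ n : ℕ, x (n + 1) = B (m + n) (x n) + s (n + 1)) ∧
        ∀ n : ℕ, ‖x n‖ ≤ h * C) :
    (∀ m n : ℕ, 1 ≤ n → ∀ v : X, ‖Φ m n v‖ ≤ h * ‖v‖) ∧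
    (∀ n₀ : ℕ, h ^ 2 / ((n₀ : ℝ) + 1) ≤ 1 / Real.exp 1 →
      (∀ (m : ℕ) (v : X), ‖Φ m n₀ v‖ ≤ (Real.exp 1)⁻¹ * ‖v‖) ∧
      (∀ m n : ℕ, 1 ≤ n → ∀ v : X,
        ‖Φ m n v‖ ≤ h * Real.exp 1 * Real.exp (-(1 / (n₀ : ℝ)) * (n : ℝ)) * ‖v‖)) := by
  have hb : ∀ (m n : ℕ) (v : X), ‖Φ m n v‖ ≤ h * ‖v‖ := by
    intro m n v
    obtain ⟨x, hx0, hxs, hxb⟩ := hadm m (fun n => if n = 0 then v else 0) ‖v‖ (by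
      intro n
      by_cases hn : n = 0 <;> simp [hn])
    have key : ∀ n, x n = Φ m n v := by
      intro n
      induction n with
      | zero => simp [hx0, hΦ0]
      | succ k ih => simp [hxs, hΦs, ih]
    rw [← key]
    exact hxb n
  have hco : ∀ (m a b : ℕ) (v : X), Φ m (a + b) v = Φ (m + a) b (Φ m a v) := by
    intro m a b v
    induction b with
    | zero => simp [hΦ0]
    | succ k ih =>
      rw [← add_assoc, hΦs, hΦs]
      simp [ih, add_assoc]
  refine ⟨fun m n _ v => hb m n v, ?_⟩
  intro n₀ hn
  have he : 0 < Real.exp 1 := Real.exp_pos 1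
  have hpos : (0 : ℝ) < (n₀ : ℝ) + 1 := by positivity
  have hc : ∀ (m : ℕ) (v : X), ‖Φ m n₀ v‖ ≤ (Real.exp 1)⁻¹ * ‖v‖ := by
    intro m v
    obtain ⟨x, hx0, hxs, hxb⟩ := hadm m (fun n => Φ m n v) (h * ‖v‖) (fun n => hb m n v)
    have key : ∀ n : ℕ, x n = ((n : ℝ) + 1) • Φ m n v := by
      intro n
      induction n with
      | zero => simp [hx0]
      | succ k ih =>
        rw [hxs, ih]
        simp only [hΦs, map_smul, ContinuousLinearMap.comp_apply]
        push_cast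
        module
    have h1 := hxb n₀
    rw [key, norm_smul, Real.norm_of_nonneg hpos.le] at h1
    have h2 : ‖Φ m n₀ v‖ ≤ h ^ 2 / ((n₀ : ℝ) + 1) * ‖v‖ := by
      rw [div_mul_eq_mul_div, le_div_iff₀ hpos]
      linarith
    refine h2.trans ?_
    rw [← one_div]
    gcongr
  refine ⟨hc, ?_⟩
  intro m n _ v
  have hn0 : 0 < n₀ := by
    rcases Nat.eq_zero_or_pos n₀ with h0 | h0
    · exfalso
      subst h0
      have h1 : 1 / Real.exp 1 < 1 := by
        rw [div_lt_one he]
        exact Real.one_lt_exp_iff.mpr one_pos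
      simp only [Nat.cast_zero, zero_add, div_one] at hn
      nlinarith
    · exact h0
  have hit : ∀ (k r m : ℕ) (v : X), ‖Φ m (n₀ * k + r) v‖ ≤ h * Real.exp (-(k : ℝ)) * ‖v‖ := by
    intro k r
    induction k with
    | zero => intro m v; simpa using hb m r v
    | succ k ih =>
      intro m v
      have e1 : n₀ * (k + 1) + r = n₀ + (n₀ * k + r) := by ring
      rw [e1, hco]
      refine (ih _ _).trans ?_
      have e2 : Real.exp (-((k + 1 : ℕ) : ℝ)) = Real.exp (-(k : ℝ)) * (Real.exp 1)⁻¹ := by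
        rw [← Real.exp_neg, ← Real.exp_add]
        push_cast
        ring_nf
      rw [e2]
      calc h * Real.exp (-(k : ℝ)) * ‖Φ m n₀ v‖
          ≤ h * Real.exp (-(k : ℝ)) * ((Real.exp 1)⁻¹ * ‖v‖) := by
            gcongr
            exact hc m v
        _ = _ := by ring
  have h1 := hit (n / n₀) (n % n₀) m v
  rw [Nat.div_add_mod] at h1
  refine h1.trans ?_
  rw [mul_assoc h (Real.exp 1), ← Real.exp_add]
  gcongr
  have hlt : (n : ℝ) ≤ n₀ * (((n / n₀ : ℕ) : ℝ) + 1) := by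
    exact_mod_cast (Nat.lt_mul_div_succ n hn0).le
  have hn0' : (0 : ℝ) < n₀ := by exact_mod_cast hn0
  have h3 : (n : ℝ) / n₀ ≤ ((n / n₀ : ℕ) : ℝ) + 1 := by
    rw [div_le_iff₀ hn0']
    linarith
  have h4 : -(1 / (n₀ : ℝ)) * (n : ℝ) = -((n : ℝ) / n₀) := by ring
  rw [h4]
  linarith
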